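/- If for each n ≥ 2 the data X_1, …, X_n are i.i.d. N(θ_0, 1) and t_w = (log n)^{-1}, then the expected WBIC of model M_N satisfies lim_{n→∞} [ E(WBIC) − E{∑_{i=1}^n log p(X_i | θ_0)} + (1/2) log n ] = 1/2; that is, E(WBIC) = E{log p(X^n | θ_0)} − (1/2) log n + 1/2 + o(1), so WBIC overestimates the two leading terms of the log marginal likelihood by 1/2 in expectation. -/

import Mathlib

open MeasureTheory ProbabilityTheory Real

/-- Normal likelihood density `p(x | θ) = (2π)^{-1/2} exp(−(x−θ)²/2)`. -/
noncomputable def normalLik (x θ : ℝ) : ℝ :=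
  (Real.sqrt (2 * Real.pi))⁻¹ * Real.exp (-(x - θ)^2 / 2)

/-- WBIC of model `M_N` for data `X`:
`WBIC = E^{t_w}[∑ᵢ log p(Xᵢ|θ)]` with `t_w = (log n)⁻¹`, the expectation being
under the tempered posterior `N(m_{t_w}, v_{t_w})`,
`m_t = (nt·X̄ + m/v)/(nt + 1/v)` and `v_t = (nt + 1/v)⁻¹`. -/
noncomputable def wbicN (n : ℕ) (m v : ℝ) (X : Fin n → ℝ) : ℝ :=
  let tw := (Real.log n)⁻¹
  let xbar := (∑ i, X i) / n
  let mt := (n * tw * xbar + m / v) / (n * tw + 1 / v)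
  let vt := (n * tw + 1 / v)⁻¹
  ∫ θ, (∑ i, Real.log (normalLik (X i) θ)) ∂(gaussianReal mt vt.toNNReal)

lemma log_normalLik (x θ : ℝ) :
    Real.log (normalLik x θ) = -Real.log (Real.sqrt (2 * Real.pi)) - (x - θ) ^ 2 / 2 := by
  have h : Real.sqrt (2 * Real.pi) ≠ 0 := by positivity
  rw [normalLik, Real.log_mul (inv_ne_zero h) (Real.exp_ne_zero _), Real.log_inv, Real.log_exp]
  ring

lemma integrable_sub_sq_gaussianReal (μ x : ℝ) (w : NNReal) :
    Integrable (fun θ => (x - θ) ^ 2) (gaussianReal μ w) :=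
  ((memLp_const x).sub (memLp_id_gaussianReal 2)).integrable_sq

lemma integral_sub_sq_gaussianReal (μ x : ℝ) (w : NNReal) :
    ∫ θ, (x - θ) ^ 2 ∂(gaussianReal μ w) = (x - μ) ^ 2 + w := by
  have h := variance_eq_sub (μ := gaussianReal μ w) (X := fun θ => x - θ)
    ((memLp_const x).sub (memLp_id_gaussianReal 2))
  have hi : Integrable (fun θ : ℝ => θ) (gaussianReal μ w) :=
    (memLp_id_gaussianReal 1).integrable le_rfl
  have hv : Var[fun θ => x - θ; gaussianReal μ w] = w := by
    rw [variance_const_sub (X := fun θ => θ) aestronglyMeasurable_id]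
    exact variance_id_gaussianReal
  have hm : ∫ θ, (x - θ) ∂(gaussianReal μ w) = x - μ := by
    rw [integral_sub (integrable_const x) hi, integral_id_gaussianReal]
    simp
  rw [hv, hm] at h
  simp only [Pi.pow_apply] at h
  linarith

lemma integral_sum_log_normalLik {n : ℕ} (X : Fin n → ℝ) (μ : ℝ) (w : NNReal) :
    ∫ θ, (∑ i, Real.log (normalLik (X i) θ)) ∂(gaussianReal μ w) =
      (∑ i, Real.log (normalLik (X i) μ)) - n * w / 2 := by
  have hsq (i : Fin n) : Integrable (fun θ => (X i - θ) ^ 2 / 2) (gaussianReal μ w) :=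
    (integrable_sub_sq_gaussianReal μ (X i) w).div_const 2
  simp only [log_normalLik]
  rw [integral_finsetSum _ fun i _ => by exact (integrable_const _).sub (hsq i)]
  simp_rw [integral_sub (integrable_const _) (hsq _), integral_div,
    integral_sub_sq_gaussianReal]
  simp [Finset.sum_sub_distrib, ← Finset.sum_div, Finset.sum_add_distrib]
  ring

section GaussianData

variable {n : ℕ} (θ₀ : ℝ)

lemma memLp_sum_sub_gaussianReal :
    MemLp (fun X : Fin n → ℝ => ∑ i, (X i - θ₀)) 2
      (Measure.pi fun _ : Fin n => gaussianReal θ₀ 1) :=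
  memLp_finsetSum _ fun i _ =>
    (((memLp_id_gaussianReal (μ := θ₀) (v := 1) 2).sub (memLp_const θ₀)).comp_measurePreserving
      (measurePreserving_eval (fun _ : Fin n => gaussianReal θ₀ 1) i))

lemma integral_sum_sub_gaussianReal :
    ∫ X, (∑ i, (X i - θ₀)) ∂(Measure.pi fun _ : Fin n => gaussianReal θ₀ 1) = 0 := by
  have hi : Integrable (fun x : ℝ => x) (gaussianReal θ₀ 1) :=
    (memLp_id_gaussianReal 1).integrable le_rfl
  have hs : Integrable (fun x : ℝ => x - θ₀) (gaussianReal θ₀ 1) := hi.sub (integrable_const _)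
  rw [integral_finsetSum _ fun i _ =>
    integrable_comp_eval (μ := fun _ : Fin n => gaussianReal θ₀ 1) (i := i) hs]
  refine Finset.sum_eq_zero fun i _ => ?_
  rw [integral_comp_eval (μ := fun _ : Fin n => gaussianReal θ₀ 1) (i := i)
    (f := fun x : ℝ => x - θ₀) hs.aestronglyMeasurable, integral_sub hi (integrable_const _),
    integral_id_gaussianReal]
  simp

lemma integral_sq_sum_sub_gaussianReal :
    ∫ X, (∑ i, (X i - θ₀)) ^ 2 ∂(Measure.pi fun _ : Fin n => gaussianReal θ₀ 1) = n := by
  have h := variance_eq_sub (memLp_sum_sub_gaussianReal (n := n) θ₀)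
  have hv := variance_sum_pi (μ := fun _ : Fin n => gaussianReal θ₀ 1)
    (X := fun _ x => x - θ₀)
    fun _ => (memLp_id_gaussianReal (μ := θ₀) (v := 1) 2).sub (memLp_const θ₀)
  have hvar : Var[fun x : ℝ => x - θ₀; gaussianReal θ₀ 1] = 1 := by
    rw [variance_sub_const (X := fun x => x) aestronglyMeasurable_id]
    exact variance_id_gaussianReal (μ := θ₀) (v := 1)
  have hfun : (∑ i : Fin n, fun X : Fin n → ℝ => X i - θ₀) = fun X => ∑ i, (X i - θ₀) := by
    ext X; simp
  rw [hfun, h, integral_sum_sub_gaussianReal] at hv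
  simpa [hvar] using hv

lemma integrable_sum_log_normalLik :
    Integrable (fun X : Fin n → ℝ => ∑ i, Real.log (normalLik (X i) θ₀))
      (Measure.pi fun _ : Fin n => gaussianReal θ₀ 1) := by
  refine integrable_finsetSum _ fun i _ =>
    integrable_comp_eval (μ := fun _ : Fin n => gaussianReal θ₀ 1) (i := i)
      (f := fun x => Real.log (normalLik x θ₀)) ?_
  simp only [log_normalLik]
  exact (integrable_const _).sub (((memLp_id_gaussianReal (μ := θ₀) (v := 1) 2).sub
    (memLp_const θ₀)).integrable_sq.div_const 2)

end GaussianData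

lemma sum_log_normalLik_add {n : ℕ} (X : Fin n → ℝ) (θ δ : ℝ) :
    ∑ i, Real.log (normalLik (X i) (θ + δ)) =
      (∑ i, Real.log (normalLik (X i) θ)) + δ * (∑ i, (X i - θ)) - n * δ ^ 2 / 2 := by
  have h (i : Fin n) : Real.log (normalLik (X i) (θ + δ)) =
      Real.log (normalLik (X i) θ) + δ * (X i - θ) - δ ^ 2 / 2 := by
    simp only [log_normalLik]; ring
  simp only [h, Finset.sum_sub_distrib, Finset.sum_add_distrib, ← Finset.mul_sum]
  simp
  ring

lemma integral_wbicN_sub {n : ℕ} (hn : n ≠ 0) (θ₀ m : ℝ) {v w a d : ℝ} (hv : 0 < v)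
    (hw : w = (n * (Real.log n)⁻¹ + 1 / v)⁻¹) (ha : a = n * (Real.log n)⁻¹ * w)
    (hd : d = (m - θ₀) / v * w) :
    (∫ X, wbicN n m v X ∂(Measure.pi fun _ : Fin n => gaussianReal θ₀ 1)) -
        (∫ X, (∑ i, Real.log (normalLik (X i) θ₀))
          ∂(Measure.pi fun _ : Fin n => gaussianReal θ₀ 1)) =
      a - a ^ 2 / 2 - n * d ^ 2 / 2 - n * w / 2 := by
  have hlog : 0 ≤ Real.log n := Real.log_natCast_nonneg n
  have hD : 0 < n * (Real.log n)⁻¹ + 1 / v := by positivity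
  have hw0 : 0 ≤ w := hw ▸ (inv_pos.2 hD).le
  have hn' : (n : ℝ) ≠ 0 := by exact_mod_cast hn
  have key (X : Fin n → ℝ) : wbicN n m v X =
      (∑ i, Real.log (normalLik (X i) θ₀)) +
        ((a - a ^ 2 / 2) / n * (∑ i, (X i - θ₀)) ^ 2 + (d - a * d) * (∑ i, (X i - θ₀)) +
          (- n * d ^ 2 / 2 - n * w / 2)) := by
    have hm : (n * (Real.log n)⁻¹ * ((∑ i, X i) / n) + m / v) / (n * (Real.log n)⁻¹ + 1 / v) =
        θ₀ + (a / n * (∑ i, (X i - θ₀)) + d) := by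
      simp only [ha, hd, hw, Finset.sum_sub_distrib, Finset.sum_const, Finset.card_univ,
        Fintype.card_fin, nsmul_eq_mul]
      have ht : 0 ≤ (Real.log n)⁻¹ := inv_nonneg.2 hlog
      clear hw ha hw0
      generalize (Real.log n)⁻¹ = t at *
      have hne : n * t * v + 1 ≠ 0 := by positivity
      field_simp
      ring
    simp only [wbicN]
    rw [integral_sum_log_normalLik, ← hw, Real.coe_toNNReal _ hw0, hm, sum_log_normalLik_add]
    field_simp
    ring
  have hS := memLp_sum_sub_gaussianReal (n := n) θ₀
  have h1 := hS.integrable_sq.const_mul ((a - a ^ 2 / 2) / n)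
  have h2 := (hS.integrable one_le_two).const_mul (d - a * d)
  simp only [key]
  rw [integral_add (integrable_sum_log_normalLik θ₀)
      (by exact (h1.add h2).add (integrable_const _)),
    integral_add (by exact h1.add h2) (integrable_const _), integral_add h1 h2, integral_const_mul,
    integral_const_mul, integral_sq_sum_sub_gaussianReal, integral_sum_sub_gaussianReal]
  simp
  field_simp
  ring

/-- if for each `n ≥ 2` the data `X₁, …, Xₙ` are i.i.d.
`N(θ₀, 1)` and `t_w = (log n)⁻¹`, then
`E(WBIC) − E{∑ᵢ log p(Xᵢ|θ₀)} + (1/2)log n → 1/2`; i.e.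
`E(WBIC) = E{log p(Xⁿ|θ₀)} − (1/2)log n + 1/2 + o(1)`, so WBIC overestimates
the two leading terms of the log marginal likelihood by `1/2` in expectation. -/
theorem normal_expected_wbic_overestimates
    (θ₀ m v : ℝ) (hv : 0 < v) :
    Filter.Tendsto
      (fun n : ℕ =>
        (∫ X, wbicN n m v X ∂(Measure.pi fun _ : Fin n => gaussianReal θ₀ 1)) -
          (∫ X, (∑ i, Real.log (normalLik (X i) θ₀))
            ∂(Measure.pi fun _ : Fin n => gaussianReal θ₀ 1)) +
          (1 / 2) * Real.log n)
      Filter.atTop (nhds (1 / 2)) := by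
  have hnat {f : ℝ → ℝ} (hf : f =o[Filter.atTop] id) :
      Filter.Tendsto (fun n : ℕ => f n / n) Filter.atTop (nhds 0) :=
    hf.tendsto_div_nhds_zero.comp tendsto_natCast_atTop_atTop
  have hr := hnat isLittleO_log_id_atTop
  have hs := hnat (isLittleO_pow_log_id_atTop (n := 2))
  have hq : Filter.Tendsto (fun n : ℕ => (1 + Real.log n / n / v)⁻¹) Filter.atTop (nhds 1) := by
    simpa using ((hr.div_const v).const_add 1).inv₀ (by simp)
  have hlim := ((hq.sub ((hq.pow 2).div_const 2)).sub
    (((hs.const_mul (((m - θ₀) / v) ^ 2)).mul (hq.pow 2)).div_const 2)).add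
    (((hs.div_const v).mul hq).div_const 2)
  norm_num only at hlim
  refine (hlim.congr' ?_).trans (by norm_num)
  filter_upwards [Filter.eventually_ge_atTop 2] with n hn
  rw [integral_wbicN_sub (by omega) θ₀ m hv rfl rfl rfl]
  have hn' : (0 : ℝ) < n := by positivity
  have hL : 0 < Real.log n := Real.log_pos (by exact_mod_cast hn)
  have hw : ((n : ℝ) * (Real.log n)⁻¹ + 1 / v)⁻¹ =
      Real.log n / n * (1 + Real.log n / n / v)⁻¹ := by
    field_simp
  have hq' : Real.log n / n / v * (1 + Real.log n / n / v)⁻¹ =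
      1 - (1 + Real.log n / n / v)⁻¹ := by
    field_simp
    ring
  simp only [hw]
  generalize (1 + Real.log n / n / v)⁻¹ = q at *
  field_simp at hq' ⊢
  linear_combination v * Real.log n * hq'
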